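/- Let F(u,v) = (u² + v² + 1)³ + (u³ + v³ + 1)² ∈ ℂ[u,v]. Then the set of singular points of the affine curve F = 0, namely {(u,v) ∈ ℂ² : F(u,v) = 0, ∂F/∂u(u,v) = 0, ∂F/∂v(u,v) = 0}, is exactly the set {(u,v) ∈ ℂ² : u² + v² + 1 = 0 and u³ + v³ + 1 = 0}. -/

import Mathlib

open MvPolynomial

/-- If `(u, v)` is a zero of `A³ + B²` and of both partial derivatives, where
`A = u² + v² + 1` and `B = u³ + v³ + 1`, then `A = 0`. By Euler's identity `B = -A²`, so `A ≠ 0`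
would force `u, v ∈ {0, 1}` and `A = -1`. -/
theorem conic_eq_zero_of_singular {u v : ℂ}
    (h : (u ^ 2 + v ^ 2 + 1) ^ 3 + (u ^ 3 + v ^ 3 + 1) ^ 2 = 0)
    (hu : u * ((u ^ 2 + v ^ 2 + 1) ^ 2 + u * (u ^ 3 + v ^ 3 + 1)) = 0)
    (hv : v * ((u ^ 2 + v ^ 2 + 1) ^ 2 + v * (u ^ 3 + v ^ 3 + 1)) = 0) :
    u ^ 2 + v ^ 2 + 1 = 0 := by
  by_contra hA
  have hB : u ^ 3 + v ^ 3 + 1 = -(u ^ 2 + v ^ 2 + 1) ^ 2 := by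
    linear_combination h - u * hu - v * hv
  rw [hB] at h hu hv
  have hA2 := pow_ne_zero 2 hA
  have hu' : u = 0 ∨ u = 1 := by
    have : u * (u - 1) = 0 := mul_left_cancel₀ hA2 (by linear_combination -hu)
    simpa [sub_eq_zero] using this
  have hv' : v = 0 ∨ v = 1 := by
    have : v * (v - 1) = 0 := mul_left_cancel₀ hA2 (by linear_combination -hv)
    simpa [sub_eq_zero] using this
  rcases hu' with rfl | rfl <;> rcases hv' with rfl | rfl <;> norm_num at h

/-- The singular points of the affine sextic curve `F = (u²+v²+1)³ + (u³+v³+1)² = 0` are exactly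
the common zeros of `u² + v² + 1` and `u³ + v³ + 1`. -/
theorem singular_points_of_dehomogenized_torus_sextic
    (F : MvPolynomial (Fin 2) ℂ)
    (hF : F = (X 0 ^ 2 + X 1 ^ 2 + 1) ^ 3 + (X 0 ^ 3 + X 1 ^ 3 + 1) ^ 2) :
    {p : Fin 2 → ℂ | eval p F = 0 ∧ ∀ i, eval p (pderiv i F) = 0} =
      {p : Fin 2 → ℂ | p 0 ^ 2 + p 1 ^ 2 + 1 = 0 ∧ p 0 ^ 3 + p 1 ^ 3 + 1 = 0} := by
  subst hF
  ext p
  simp only [Set.mem_ofPred_eq, Fin.forall_fin_two, map_add, map_pow, eval_X, map_one,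
    Derivation.leibniz_pow, pderiv_X, pderiv_one, smul_eq_mul, nsmul_eq_mul, map_mul, map_ofNat,
    Pi.single_apply, Fin.isValue, if_true, zero_ne_one, one_ne_zero, if_false, map_zero, mul_zero,
    add_zero, zero_add, mul_one, Nat.cast_ofNat, Nat.reduceSub, pow_one]
  constructor
  · rintro ⟨h, hu, hv⟩
    have hA := conic_eq_zero_of_singular h (by linear_combination hu / 6)
      (by linear_combination hv / 6)
    rw [hA] at h
    exact ⟨hA, by simpa using h⟩
  · rintro ⟨hA, hB⟩
    simp [hA, hB]
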